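/- Assume r_j ≤ 1 for all outcomes j. There is an absolute constant A > 0 such that for every ε, δ ∈ (0,1) and every N ≥ A·(1/ε²)·(log(1/ε) + log(1/δ)) there exists a function 𝒜 : Θ_all^N → C_linear such that for every finitely supported probability distribution D on Θ_all, with probability at least 1 − δ over the i.i.d. sample S ∼ D^N, the returned linear contract satisfies E_{θ∼D}[u_p(θ, 𝒜(S))] ≥ OPT(C_linear, D) − ε. -/

import Mathlib

open scoped BigOperators

/-- An agent type in the hidden-action principal-agent model with `n` actions and
`m` outcomes: a production function `f` (a distribution over outcomes for each action)
and a nonnegative cost vector `c` with `c 0 = 0`. -/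
structure AgentType (n m : ℕ) where
  f : Fin n → Fin m → ℝ
  c : Fin n → ℝ
  f_nonneg : ∀ i j, 0 ≤ f i j
  f_sum : ∀ i, ∑ j, f i j = 1
  c_nonneg : ∀ i, 0 ≤ c i
  c_zero : ∀ i : Fin n, (i : ℕ) = 0 → c i = 0

/-- The agent's expected utility for action `i` under contract `t`. -/
def uA {n m : ℕ} (θ : AgentType n m) (t : Fin m → ℝ) (i : Fin n) : ℝ :=
  (∑ j, θ.f i j * t j) - θ.c i

/-- The principal's expected utility when the agent takes action `i` under contract `t`,
with rewards `r`. -/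
def uPa {n m : ℕ} (r : Fin m → ℝ) (θ : AgentType n m) (t : Fin m → ℝ) (i : Fin n) : ℝ :=
  ∑ j, θ.f i j * (r j - t j)

/-- The set of the agent's best-response actions to contract `t`. -/
def BestResp {n m : ℕ} (θ : AgentType n m) (t : Fin m → ℝ) : Set (Fin n) :=
  {i | ∀ i', uA θ t i' ≤ uA θ t i}

/-- The principal's utility under contract `t`: the agent best-responds, breaking ties
in favor of the principal. -/
noncomputable def uP {n m : ℕ} (r : Fin m → ℝ) (θ : AgentType n m) (t : Fin m → ℝ) : ℝ :=
  sSup (uPa r θ t '' BestResp θ t)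

/-- The class of linear contracts `α • r`, `α ∈ [0,1]`. -/
def Clinear {m : ℕ} (r : Fin m → ℝ) : Set (Fin m → ℝ) :=
  {t | ∃ α : ℝ, α ∈ Set.Icc (0:ℝ) 1 ∧ t = fun j => α * r j}

/-- The class of bounded contracts `[0,1]^m`. -/
def Cbounded (m : ℕ) : Set (Fin m → ℝ) := {t | ∀ j, t j ∈ Set.Icc (0:ℝ) 1}

/-- The class of unbounded contracts `ℝ_{≥0}^m`. -/
def Cunbounded (m : ℕ) : Set (Fin m → ℝ) := {t | ∀ j, 0 ≤ t j}

/-- A finitely supported probability distribution. -/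
structure FinDist (α : Type*) where
  p : α → ℝ
  nonneg : ∀ a, 0 ≤ p a
  finite_support : (Function.support p).Finite
  total : ∑ᶠ a, p a = 1

/-- Expectation of `g` under a finitely supported distribution `D`. -/
noncomputable def expect {α : Type*} (D : FinDist α) (g : α → ℝ) : ℝ :=
  ∑ᶠ a, D.p a * g a

/-- `OPT(C, D)`: the supremum over contracts in `C` of the principal's expected utility. -/
noncomputable def OPT {n m : ℕ} (C : Set (Fin m → ℝ)) (r : Fin m → ℝ)
    (D : FinDist (AgentType n m)) : ℝ :=
  sSup ((fun t => expect D (fun θ => uP r θ t)) '' C)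

/-- Pseudo-dimension shattering: `C` shatters some `k` types in `Θ`. -/
def Shatters {n m : ℕ} (r : Fin m → ℝ) (C : Set (Fin m → ℝ))
    (Θ : Set (AgentType n m)) (k : ℕ) : Prop :=
  ∃ θ : Fin k → AgentType n m, (∀ j, θ j ∈ Θ) ∧ ∃ τ : Fin k → ℝ,
    ∀ S : Finset (Fin k), ∃ t ∈ C,
      (∀ j, j ∈ S → τ j ≤ uP r (θ j) t) ∧ (∀ j, j ∉ S → uP r (θ j) t < τ j)

/-- `Cbar` is an `ε`-approximation of `C` (representation error at most `ε`). -/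
def IsApprox (n : ℕ) {m : ℕ} (r : Fin m → ℝ) (Cbar C : Set (Fin m → ℝ)) (ε : ℝ) : Prop :=
  ∀ D : FinDist (AgentType n m), OPT Cbar r D ≥ OPT C r D - ε

/-- Best responses breaking ties in favor of the principal. -/
def BestRespP {n m : ℕ} (r : Fin m → ℝ) (θ : AgentType n m) (t : Fin m → ℝ) : Set (Fin n) :=
  {i | i ∈ BestResp θ t ∧ ∀ i' ∈ BestResp θ t, uPa r θ t i' ≤ uPa r θ t i}

/-- Principal's expected reward under the linear contract `α • r`. -/
noncomputable def rP {n m : ℕ} (r : Fin m → ℝ) (θ : AgentType n m) (α : ℝ) : ℝ :=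
  sSup ((fun i => ∑ j, θ.f i j * r j) '' BestRespP r θ (fun j => α * r j))

/-- The set of critical values of an agent type for linear contracts. -/
def CritSet {n m : ℕ} (r : Fin m → ℝ) (θ : AgentType n m) : Set ℝ :=
  {α | α ∈ Set.Ioc (0:ℝ) 1 ∧ ∀ ε : ℝ, 0 < ε → ε ≤ α → rP r θ (α - ε) ≠ rP r θ α}

/-- Probability of the event `E` under `N` i.i.d. samples from `D`. -/
noncomputable def prodProb {α : Type*} (D : FinDist α) (N : ℕ) (E : Set (Fin N → α)) : ℝ :=
  ∑ᶠ s ∈ E, ∏ i, D.p (s i)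

/-- The class of `ε`-discrete linear contracts. -/
def Leps {m : ℕ} (r : Fin m → ℝ) (ε : ℝ) : Set (Fin m → ℝ) :=
  {t | ∃ α : ℝ, ((∃ k : ℕ, α = k * ε ∧ k * ε ≤ 1) ∨ α = 1) ∧ t = fun j => α * r j}

/-- The expectation as a finite sum over the support. -/
lemma expect_eq_sum {α : Type*} (D : FinDist α) (g : α → ℝ) :
    expect D g = ∑ a ∈ D.finite_support.toFinset, D.p a * g a := by
  refine finsum_eq_sum_of_support_subset _ fun a ha => ?_
  simp only [Set.Finite.coe_toFinset, Function.mem_support] at ha ⊢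
  exact left_ne_zero_of_mul ha

lemma FinDist.sum_support {α : Type*} (D : FinDist α) :
    ∑ a ∈ D.finite_support.toFinset, D.p a = 1 := by
  rw [← D.total]
  exact (finsum_eq_sum_of_support_subset _ (by simp)).symm

lemma expect_mono {α : Type*} (D : FinDist α) {g h : α → ℝ} (hgh : ∀ a, g a ≤ h a) :
    expect D g ≤ expect D h := by
  rw [expect_eq_sum, expect_eq_sum]
  exact Finset.sum_le_sum fun a _ => mul_le_mul_of_nonneg_left (hgh a) (D.nonneg a)

lemma expect_add_const {α : Type*} (D : FinDist α) (g : α → ℝ) (b : ℝ) :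
    expect D (fun a => g a + b) = expect D g + b := by
  simp only [expect_eq_sum, mul_add, Finset.sum_add_distrib, ← Finset.sum_mul, D.sum_support,
    one_mul]

lemma expect_neg {α : Type*} (D : FinDist α) (g : α → ℝ) :
    expect D (fun a => -g a) = -expect D g := by
  simp only [expect_eq_sum, mul_neg, Finset.sum_neg_distrib]

open Classical in
/-- The probability of an event as a finite sum over the samples from the support. -/
lemma prodProb_eq_sum {α : Type*} (D : FinDist α) (N : ℕ) (E : Set (Fin N → α)) :
    prodProb D N E = ∑ s ∈ Fintype.piFinset fun _ : Fin N => D.finite_support.toFinset,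
      (∏ i, D.p (s i)) * if s ∈ E then 1 else 0 := by
  rw [prodProb, finsum_mem_def]
  rw [finsum_eq_sum_of_support_subset (s := Fintype.piFinset fun _ => D.finite_support.toFinset)]
  · refine Finset.sum_congr rfl fun s _ => ?_
    simp [Set.indicator_apply]
  · intro s hs
    have h : ∏ i, D.p (s i) ≠ 0 := fun h0 => hs (by simp [Set.indicator_apply, h0])
    simpa [Fintype.mem_piFinset, Finset.prod_ne_zero_iff] using h

lemma sum_prod_support {α : Type*} (D : FinDist α) (N : ℕ) (g : α → ℝ) :
    ∑ s ∈ Fintype.piFinset fun _ : Fin N => D.finite_support.toFinset,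
      (∏ i, D.p (s i)) * ∏ i, g (s i) = expect D g ^ N := by
  have h := Finset.prod_univ_sum (fun _ : Fin N => D.finite_support.toFinset)
    (fun _ a => D.p a * g a)
  rw [expect_eq_sum, ← Fin.prod_const, h]
  exact Finset.sum_congr rfl fun s _ => Finset.prod_mul_distrib.symm

lemma prodProb_mono {α : Type*} (D : FinDist α) (N : ℕ) {E F : Set (Fin N → α)} (h : E ⊆ F) :
    prodProb D N E ≤ prodProb D N F := by
  classical
  rw [prodProb_eq_sum, prodProb_eq_sum]
  refine Finset.sum_le_sum fun s _ =>
    mul_le_mul_of_nonneg_left ?_ (Finset.prod_nonneg fun i _ => D.nonneg _)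
  by_cases hs : s ∈ E
  · rw [if_pos hs, if_pos (h hs)]
  · rw [if_neg hs]
    split_ifs <;> norm_num

/-- Union bound. -/
lemma one_sub_le_prodProb {α ι : Type*} [Fintype ι] (D : FinDist α) (N : ℕ)
    (E : Set (Fin N → α)) (B : ι → Set (Fin N → α)) (hB : ∀ s, s ∉ E → ∃ k, s ∈ B k) :
    1 - ∑ k, prodProb D N (B k) ≤ prodProb D N E := by
  classical
  have htot := sum_prod_support D N (fun _ => 1)
  have h1 : expect D (fun _ => 1) = 1 := by simp [expect_eq_sum, D.sum_support]
  rw [h1, one_pow] at htot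
  rw [← htot, sub_le_iff_le_add]
  simp only [prodProb_eq_sum]
  rw [Finset.sum_comm, ← Finset.sum_add_distrib]
  refine Finset.sum_le_sum fun s _ => ?_
  rw [← Finset.mul_sum, ← mul_add]
  refine mul_le_mul_of_nonneg_left ?_ (Finset.prod_nonneg fun i _ => D.nonneg _)
  have hnn : ∀ k ∈ Finset.univ, (0 : ℝ) ≤ if s ∈ B k then 1 else 0 := fun k _ => by
    split_ifs <;> norm_num
  rw [Finset.prod_const_one]
  by_cases hs : s ∈ E
  · rw [if_pos hs]
    linarith [Finset.sum_nonneg hnn]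
  · obtain ⟨k, hk⟩ := hB s hs
    have := Finset.single_le_sum hnn (Finset.mem_univ k)
    rw [if_pos hk] at this
    rw [if_neg hs]
    linarith

lemma exp_mul_le_cosh_add {x : ℝ} (h1 : -1 ≤ x) (h2 : x ≤ 1) (l : ℝ) :
    Real.exp (l * x) ≤ Real.cosh l + x * Real.sinh l := by
  have h := convexOn_exp.2 (Set.mem_univ l) (Set.mem_univ (-l))
    (show 0 ≤ (1 + x) / 2 by linarith) (show 0 ≤ (1 - x) / 2 by linarith) (by ring)
  simp only [smul_eq_mul] at h
  rw [show (1 + x) / 2 * l + (1 - x) / 2 * -l = l * x by ring] at h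
  rw [Real.cosh_eq, Real.sinh_eq]
  linarith

/-- A form of Hoeffding's inequality for random variables within `1` of their mean. -/
lemma prodProb_upper_tail_le {α : Type*} (D : FinDist α) (N : ℕ) (g : α → ℝ)
    (hg : ∀ a, g a - expect D g ∈ Set.Icc (-1 : ℝ) 1) {t : ℝ} (ht : 0 ≤ t) :
    prodProb D N {s | N * (expect D g + t) ≤ ∑ i, g (s i)} ≤ Real.exp (-(N * t ^ 2 / 2)) := by
  classical
  set μ := expect D g with hμ
  have hmgf : expect D (fun a => Real.exp (t * (g a - μ))) ≤ Real.exp (t ^ 2 / 2) := by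
    refine le_trans ?_ (Real.cosh_le_exp_half_sq t)
    refine (expect_mono D fun a => exp_mul_le_cosh_add (hg a).1 (hg a).2 t).trans_eq ?_
    have : expect D (fun a => (g a - μ) * Real.sinh t) = 0 := by
      rw [expect_eq_sum]
      simp only [← mul_assoc, mul_sub, ← Finset.sum_mul, Finset.sum_sub_distrib, D.sum_support]
      rw [← expect_eq_sum, ← hμ]
      ring
    simp only [add_comm (Real.cosh t), expect_add_const, this, zero_add]
  have hpos : 0 ≤ expect D (fun a => Real.exp (t * (g a - μ))) := by
    rw [expect_eq_sum]
    exact Finset.sum_nonneg fun a _ => mul_nonneg (D.nonneg a) (Real.exp_pos _).le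
  calc prodProb D N {s | N * (μ + t) ≤ ∑ i, g (s i)}
      ≤ ∑ s ∈ Fintype.piFinset fun _ : Fin N => D.finite_support.toFinset,
          (∏ i, D.p (s i)) * ((∏ i, Real.exp (t * (g (s i) - μ))) * Real.exp (-(N * t ^ 2))) := by
        rw [prodProb_eq_sum]
        refine Finset.sum_le_sum fun s _ => ?_
        refine mul_le_mul_of_nonneg_left ?_ (Finset.prod_nonneg fun i _ => D.nonneg _)
        rw [← Real.exp_sum, ← Real.exp_add]
        split_ifs with hs
        · rw [Real.one_le_exp_iff, ← Finset.mul_sum, Finset.sum_sub_distrib]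
          simp only [Finset.sum_const, Finset.card_univ, Fintype.card_fin, nsmul_eq_mul]
          nlinarith [mul_le_mul_of_nonneg_left (Set.mem_ofPred_eq ▸ hs) ht]
        · exact (Real.exp_pos _).le
    _ = expect D (fun a => Real.exp (t * (g a - μ))) ^ N * Real.exp (-(N * t ^ 2)) := by
        rw [← sum_prod_support D N fun a => Real.exp (t * (g a - μ)), Finset.sum_mul]
        exact Finset.sum_congr rfl fun s _ => (mul_assoc _ _ _).symm
    _ ≤ Real.exp (t ^ 2 / 2) ^ N * Real.exp (-(N * t ^ 2)) := by gcongr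
    _ = Real.exp (-(N * t ^ 2 / 2)) := by
        rw [← Real.exp_nat_mul, ← Real.exp_add]
        ring_nf

/-- Empirical risk maximization over a finite class of `[0,1]`-valued functions. -/
lemma exists_empirical_maximizer {α ι : Type*} [Fintype ι] [Nonempty ι] (N : ℕ)
    (g : ι → α → ℝ) (hg : ∀ k a, g k a ∈ Set.Icc (0 : ℝ) 1) {t : ℝ} (ht : 0 ≤ t) :
    ∃ sel : (Fin N → α) → ι, ∀ D : FinDist α,
      1 - 2 * Fintype.card ι * Real.exp (-(N * t ^ 2 / 2)) ≤
        prodProb D N {s | ∀ k, expect D (g k) ≤ expect D (g (sel s)) + 2 * t} := by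
  have hmax : ∀ s : Fin N → α, ∃ k, ∀ k', ∑ i, g k' (s i) ≤ ∑ i, g k (s i) := fun s =>
    Finite.exists_max fun k => ∑ i, g k (s i)
  choose sel hsel using hmax
  refine ⟨sel, fun D => ?_⟩
  have hmean : ∀ k, expect D (g k) ∈ Set.Icc (0 : ℝ) 1 := fun k => by
    have hc : ∀ b : ℝ, expect D (fun _ => b) = b := fun b => by
      simp [expect_eq_sum, ← Finset.sum_mul, D.sum_support]
    exact ⟨(hc 0).symm.trans_le (expect_mono D fun a => (hg k a).1),
      (expect_mono D fun a => (hg k a).2).trans_eq (hc 1)⟩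
  have hup : ∀ k, prodProb D N {s | N * (expect D (g k) + t) ≤ ∑ i, g k (s i)} ≤
      Real.exp (-(N * t ^ 2 / 2)) := fun k =>
    prodProb_upper_tail_le D N (g k) (fun a => ⟨by linarith [(hg k a).1, (hmean k).2],
      by linarith [(hg k a).2, (hmean k).1]⟩) ht
  have hlo : ∀ k, prodProb D N {s | N * (expect D (fun a => -g k a) + t) ≤ ∑ i, -g k (s i)} ≤
      Real.exp (-(N * t ^ 2 / 2)) := fun k =>
    prodProb_upper_tail_le D N (fun a => -g k a) (fun a => by
      rw [expect_neg]
      exact ⟨by linarith [(hg k a).2, (hmean k).1], by linarith [(hg k a).1, (hmean k).2]⟩) ht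
  refine le_trans ?_ (one_sub_le_prodProb D N _ (Sum.elim
    (fun k => {s | N * (expect D (g k) + t) ≤ ∑ i, g k (s i)})
    (fun k => {s | N * (expect D (fun a => -g k a) + t) ≤ ∑ i, -g k (s i)})) ?_)
  · rw [Fintype.sum_sum_type]
    simp only [Sum.elim_inl, Sum.elim_inr]
    have h1 := Finset.sum_le_sum fun k (_ : k ∈ Finset.univ) => hup k
    have h2 := Finset.sum_le_sum fun k (_ : k ∈ Finset.univ) => hlo k
    simp only [Finset.sum_const, Finset.card_univ, nsmul_eq_mul] at h1 h2
    linarith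
  · intro s hs
    by_contra! hcon
    refine hs fun k => ?_
    have h1 := hcon (Sum.inl (sel s))
    have h2 := hcon (Sum.inr k)
    simp only [Sum.elim_inl, Sum.elim_inr, Set.mem_ofPred_eq, not_le, expect_neg,
      Finset.sum_neg_distrib] at h1 h2
    have h3 := hsel s k
    have hN : (0 : ℝ) ≤ N := Nat.cast_nonneg N
    by_contra! hlt
    nlinarith

/-- Under a linear contract the principal keeps a `1 - α` share of a reward which does not
decrease when the agent's share is raised. -/
lemma uP_linear {n m : ℕ} [NeZero n] {r : Fin m → ℝ} (hr0 : ∀ j, 0 ≤ r j) (hr1 : ∀ j, r j ≤ 1)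
    (θ : AgentType n m) {α : ℝ} :
    ∃ R ∈ Set.Icc (0 : ℝ) 1, uP r θ (fun j => α * r j) = (1 - α) * R ∧
      ∀ β, α ≤ β → β ≤ 1 → (1 - β) * R ≤ uP r θ (fun j => β * r j) := by
  have hA : ∀ (a : ℝ) i, uA θ (fun j => a * r j) i = a * (∑ j, θ.f i j * r j) - θ.c i := by
    intro a i
    rw [uA, Finset.mul_sum]
    exact congrArg (· - _) (Finset.sum_congr rfl fun j _ => by ring)
  have hP : ∀ (a : ℝ) i, uPa r θ (fun j => a * r j) i = (1 - a) * ∑ j, θ.f i j * r j := by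
    intro a i
    rw [uPa, Finset.mul_sum]
    exact Finset.sum_congr rfl fun j _ => by ring
  have hne : ∀ t, (BestResp θ t).Nonempty := fun t => Finite.exists_max (uA θ t)
  have hfin : ∀ t, (uPa r θ t '' BestResp θ t).Finite := fun t => (Set.toFinite _).image _
  obtain ⟨i, hi, hiP⟩ := ((hne fun j => α * r j).image _).csSup_mem (hfin fun j => α * r j)
  refine ⟨∑ j, θ.f i j * r j, ⟨Finset.sum_nonneg fun j _ => mul_nonneg (θ.f_nonneg i j) (hr0 j),
    ?_⟩, ?_, fun β hαβ hβ => ?_⟩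
  · rw [← θ.f_sum i]
    exact Finset.sum_le_sum fun j _ => mul_le_of_le_one_right (θ.f_nonneg i j) (hr1 j)
  · rw [uP, ← hiP, hP]
  · rcases hαβ.eq_or_lt with rfl | hlt
    · rw [uP, ← hiP, hP]
    · obtain ⟨k, hk⟩ := hne fun j => β * r j
      refine le_trans ?_ (le_csSup (hfin _).bddAbove ⟨k, hk, rfl⟩)
      rw [hP]
      refine mul_le_mul_of_nonneg_left ?_ (by linarith)
      have h1 := hi k
      have h2 := hk i
      rw [hA, hA] at h1 h2
      by_contra! hcon
      nlinarith

lemma uP_linear_mem_Icc {n m : ℕ} [NeZero n] {r : Fin m → ℝ} (hr0 : ∀ j, 0 ≤ r j)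
    (hr1 : ∀ j, r j ≤ 1) (θ : AgentType n m) {α : ℝ} (hα : α ∈ Set.Icc (0 : ℝ) 1) :
    uP r θ (fun j => α * r j) ∈ Set.Icc (0 : ℝ) 1 := by
  obtain ⟨R, hR, h, -⟩ := uP_linear hr0 hr1 θ (α := α)
  rw [h]
  exact ⟨mul_nonneg (by linarith [hα.2]) hR.1,
    mul_le_one₀ (by linarith [hα.1]) hR.1 hR.2⟩

/-- Raising the agent's share costs the principal at most the increase. -/
lemma uP_linear_le_add {n m : ℕ} [NeZero n] {r : Fin m → ℝ} (hr0 : ∀ j, 0 ≤ r j)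
    (hr1 : ∀ j, r j ≤ 1) (θ : AgentType n m) {α β : ℝ} (hαβ : α ≤ β) (hβ : β ≤ 1) :
    uP r θ (fun j => α * r j) ≤ uP r θ (fun j => β * r j) + (β - α) := by
  obtain ⟨R, hR, h, h'⟩ := uP_linear hr0 hr1 θ (α := α)
  have := h' β hαβ hβ
  rw [h]
  nlinarith [hR.2]

lemma uP_linear_le_half_add {n m : ℕ} [NeZero n] {r : Fin m → ℝ} (hr0 : ∀ j, 0 ≤ r j)
    (hr1 : ∀ j, r j ≤ 1) (θ : AgentType n m) {α : ℝ} (hα : α ∈ Set.Icc (0 : ℝ) 1) :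
    uP r θ (fun j => α * r j) ≤ uP r θ (fun j => 1 / 2 * r j) + 1 / 2 := by
  rcases le_total α (1 / 2) with h | h
  · linarith [uP_linear_le_add hr0 hr1 θ h (by norm_num), hα.1]
  · have h0 := (uP_linear_mem_Icc hr0 hr1 θ (α := 1 / 2) (by norm_num)).1
    obtain ⟨R, hR, h1, -⟩ := uP_linear hr0 hr1 θ (α := α)
    rw [h1]
    nlinarith [hR.1, hR.2, hα.2]

lemma OPT_Clinear_le {n m : ℕ} {r : Fin m → ℝ} {D : FinDist (AgentType n m)} {b : ℝ}
    (h : ∀ α ∈ Set.Icc (0 : ℝ) 1, expect D (fun θ => uP r θ fun j => α * r j) ≤ b) :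
    OPT (Clinear r) r D ≤ b := by
  refine csSup_le (Set.Nonempty.image _ ⟨_, 0, by simp, rfl⟩) ?_
  rintro _ ⟨_, ⟨α, hα, rfl⟩, rfl⟩
  exact h α hα

/-- The sample size is large enough for the union bound over a grid of mesh `ε / 2`. -/
lemma grid_failure_le {ε δ : ℝ} (hε : 0 < ε) (hε2 : ε < 1 / 2) (hδ : 0 < δ) (hδ1 : δ < 1)
    {N : ℕ} (hN : (N : ℝ) ≥ 160 * (1 / ε ^ 2) * (Real.log (1 / ε) + Real.log (1 / δ)))
    {K : ℝ} (hK : K ≤ 4 / ε) :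
    2 * K * Real.exp (-(N * (ε / 4) ^ 2 / 2)) ≤ δ := by
  have hexp : Real.exp (-(N * (ε / 4) ^ 2 / 2)) ≤ ε ^ 5 * δ ^ 5 := by
    have h : ε ^ 5 * δ ^ 5 = Real.exp (5 * Real.log ε + 5 * Real.log δ) := by
      rw [Real.exp_add, mul_comm 5, mul_comm 5, Real.exp_mul, Real.exp_mul, Real.exp_log hε,
        Real.exp_log hδ]
      norm_cast
    rw [h, Real.exp_le_exp]
    rw [one_div δ, Real.log_inv, one_div ε, Real.log_inv] at hN
    have h2 := mul_le_mul_of_nonneg_right hN (sq_nonneg ε)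
    have h3 : 160 * (1 / ε ^ 2) * (-Real.log ε + -Real.log δ) * ε ^ 2 =
        160 * (-Real.log ε + -Real.log δ) := by field_simp
    rw [h3] at h2
    nlinarith
  have hδ5 : δ ^ 5 ≤ δ := pow_le_of_le_one hδ.le hδ1.le (by norm_num)
  have hε4 : ε ^ 4 ≤ (1 / 2) ^ 4 := by gcongr
  calc 2 * K * Real.exp (-(N * (ε / 4) ^ 2 / 2))
      ≤ 2 * (4 / ε) * (ε ^ 5 * δ ^ 5) := by gcongr
    _ = 8 * ε ^ 4 * δ ^ 5 := by field_simp; ring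
    _ ≤ 1 * δ := by gcongr; linarith
    _ = δ := one_mul δ

/-- Efficient learning of linear contracts. With rewards at most `1`,
there is an absolute constant `A > 0` such that for all `ε, δ ∈ (0,1)` and every
`N ≥ A·(1/ε²)·(log(1/ε) + log(1/δ))` there is a learning rule `𝒜` mapping samples of
size `N` to linear contracts such that for every finitely supported `D`, with
probability at least `1 − δ` the returned contract is `ε`-optimal for `C_linear`. -/
theorem stmt_11 : ∃ A : ℝ, 0 < A ∧
    ∀ (n m : ℕ), 1 ≤ n → 2 ≤ m → ∀ r : Fin m → ℝ,
      (∀ j, 0 ≤ r j) → (∀ j : Fin m, (j : ℕ) = 0 → r j = 0) → (∀ j, r j ≤ 1) →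
      ∀ ε δ : ℝ, 0 < ε → ε < 1 → 0 < δ → δ < 1 →
      ∀ N : ℕ, (N : ℝ) ≥ A * (1/ε^2) * (Real.log (1/ε) + Real.log (1/δ)) →
      ∃ 𝒜 : (Fin N → AgentType n m) → (Fin m → ℝ),
        (∀ s, 𝒜 s ∈ Clinear r) ∧
        ∀ D : FinDist (AgentType n m),
          prodProb D N
            {s | expect D (fun θ => uP r θ (𝒜 s)) ≥ OPT (Clinear r) r D - ε} ≥ 1 - δ := by
  refine ⟨160, by norm_num, fun n m hn _ r hr0 _ hr1 ε δ hε hε1 hδ hδ1 N hN => ?_⟩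
  have : NeZero n := ⟨by omega⟩
  rcases lt_or_ge ε (1 / 2) with hε2 | hε2
  · obtain ⟨M, hM⟩ : ∃ M, M = ⌈2 / ε⌉₊ := ⟨_, rfl⟩
    have hM1 : 2 / ε ≤ M := hM ▸ Nat.le_ceil _
    have hM2 : (M : ℝ) < 2 / ε + 1 := hM ▸ Nat.ceil_lt_add_one (by positivity)
    have hM0 : (0 : ℝ) < M := lt_of_lt_of_le (by positivity) hM1
    have hgrid : ∀ k : Fin (M + 1), (k : ℝ) / M ∈ Set.Icc (0 : ℝ) 1 := fun k =>
      ⟨by positivity, (div_le_one hM0).2 (by exact_mod_cast Nat.lt_succ_iff.1 k.2)⟩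
    obtain ⟨sel, hsel⟩ := exists_empirical_maximizer N
      (fun (k : Fin (M + 1)) (θ : AgentType n m) => uP r θ fun j => (k : ℝ) / M * r j)
      (fun k θ => uP_linear_mem_Icc hr0 hr1 θ (hgrid k)) (show 0 ≤ ε / 4 by positivity)
    refine ⟨fun s j => (sel s : ℝ) / M * r j, fun s => ⟨_, hgrid _, rfl⟩, fun D => ?_⟩
    have hcard : ((Fintype.card (Fin (M + 1)) : ℕ) : ℝ) ≤ 4 / ε := by
      rw [Fintype.card_fin]
      push_cast
      have h2 : 2 ≤ 2 / ε := by rw [le_div_iff₀ hε]; linarith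
      have h4 : 4 / ε = 2 / ε + 2 / ε := by ring
      linarith
    refine le_trans (sub_le_sub_left (grid_failure_le hε hε2 hδ hδ1 hN hcard) 1)
      ((hsel D).trans (prodProb_mono D N fun s hs => ?_))
    rw [Set.mem_ofPred_eq, ge_iff_le, sub_le_iff_le_add]
    refine OPT_Clinear_le fun α hα => ?_
    have hk : ⌈α * M⌉₊ ≤ M := Nat.ceil_le.2 (by nlinarith [hα.2])
    have hle : α ≤ (⌈α * M⌉₊ : ℝ) / M := (le_div_iff₀ hM0).2 (Nat.le_ceil _)
    have hlt : (⌈α * M⌉₊ : ℝ) / M ≤ α + ε / 2 := by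
      rw [div_le_iff₀ hM0]
      have h1 := Nat.ceil_lt_add_one (mul_nonneg hα.1 hM0.le)
      have h2 : 2 ≤ M * ε := (div_le_iff₀ hε).1 hM1
      nlinarith
    have hs' := hs ⟨⌈α * M⌉₊, Nat.lt_succ_of_le hk⟩
    refine (expect_mono D fun θ => (uP_linear_le_add hr0 hr1 θ hle
      (hgrid ⟨⌈α * M⌉₊, Nat.lt_succ_of_le hk⟩).2).trans (add_le_add_right
        (show (⌈α * M⌉₊ : ℝ) / M - α ≤ ε / 2 by linarith) _)).trans ?_
    rw [expect_add_const]
    linarith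
  · refine ⟨fun _ j => 1 / 2 * r j, fun _ => ⟨1 / 2, by norm_num, rfl⟩, fun D => ?_⟩
    have h := one_sub_le_prodProb D N
      {s | expect D (fun θ => uP r θ fun j => 1 / 2 * r j) ≥ OPT (Clinear r) r D - ε}
      (Empty.elim : Empty → Set _) fun s hs => (hs ?_).elim
    · simp only [Finset.univ_eq_empty, Finset.sum_empty, sub_zero] at h
      linarith
    · rw [Set.mem_ofPred_eq, ge_iff_le, sub_le_iff_le_add]
      refine OPT_Clinear_le fun α hα => ?_
      refine (expect_mono D fun θ => uP_linear_le_half_add hr0 hr1 θ hα).trans ?_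
      rw [expect_add_const]
      linarith
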